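/- Suppose G ∈ F and κ(G) ≥ 2. Then for all vertices u, v, w of G and all Kuratowski witnesses H_u, H_v, H_w for u, v, w respectively: (i) V(H_u) ∩ V(H_v) ≠ ∅; (ii) if V(H_u) ∩ V(H_v) ∩ V(H_w) = ∅, then E(G) = E(H_u) ∪ E(H_v) ∪ E(H_w); (iii) if V(H_u) ∩ V(H_v) ∩ V(H_w) = ∅ and x ∈ V(H_u) \ (V(H_v) ∪ V(H_w)), then x is a branch vertex of H_u; (iv) if κ(G) = 2, S is a 2-cut of G, and s ∈ S, then every Kuratowski witness H_s for s satisfies V(H_s) ⊆ V(C⁺) for some augmented component C⁺ of G − S. -/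

import Mathlib

open SimpleGraph

/-- The complete graph on five vertices. -/
def K5 : SimpleGraph (Fin 5) := ⊤

/-- The complete bipartite graph `K_{3,3}`. -/
def K33 : SimpleGraph (Fin 6) :=
  SimpleGraph.fromRel (fun i j => i.val < 3 ∧ 3 ≤ j.val)

/-- `K_{3,3}` plus one extra edge joining two vertices in the same part. -/
def K33e : SimpleGraph (Fin 6) :=
  SimpleGraph.fromRel (fun i j => (i.val < 3 ∧ 3 ≤ j.val) ∨ (i.val = 0 ∧ j.val = 1))

/-- `H` is a minor of `G`, witnessed by a family of nonempty, connected,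
pairwise disjoint branch sets together with edges between the branch sets of
adjacent vertices of `H`. -/
def SimpleGraph.IsMinorOf {W V : Type} (H : SimpleGraph W) (G : SimpleGraph V) : Prop :=
  ∃ f : W → Set V,
    (∀ w, (G.induce (f w)).Connected) ∧
    (Pairwise fun w w' => Disjoint (f w) (f w')) ∧
    (∀ ⦃w w'⦄, H.Adj w w' → ∃ u ∈ f w, ∃ v ∈ f w', G.Adj u v)

/-- Planarity, via the Kuratowski–Wagner characterization: a (finite simple) graph is
planar iff it has no `K₅` minor and no `K_{3,3}` minor. -/
def IsPlanar {V : Type} (G : SimpleGraph V) : Prop :=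
  ¬ K5.IsMinorOf G ∧ ¬ K33.IsMinorOf G

/-- A graph is apex if it is planar or some vertex deletion makes it planar. -/
def IsApex {V : Type} (G : SimpleGraph V) : Prop :=
  IsPlanar G ∨ ∃ v : V, IsPlanar (G.induce {u | u ≠ v})

/-- `G` is an obstruction for the apex family: it is not apex, but every minor of it
that is not isomorphic to it is apex. -/
def IsApexObstruction {V : Type} (G : SimpleGraph V) : Prop :=
  ¬ IsApex G ∧
    ∀ (W : Type) (H : SimpleGraph W), H.IsMinorOf G → IsEmpty (H ≃g G) → IsApex H

/-- Subdivide the edge `uv` of `G`: the new vertex is `none`. -/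
def subdivideEdge {V : Type} (G : SimpleGraph V) (u v : V) : SimpleGraph (Option V) :=
  SimpleGraph.fromRel (fun x y =>
    (∃ a b, x = some a ∧ y = some b ∧ G.Adj a b ∧ s(a, b) ≠ s(u, v)) ∨
    (x = none ∧ (y = some u ∨ y = some v)))

/-- `IsSubdivision G H` : `H` is (isomorphic to) a graph obtained from `G` by repeatedly
subdividing edges. -/
inductive IsSubdivision : {V : Type} → SimpleGraph V → {W : Type} → SimpleGraph W → Prop
  | of_iso {V W : Type} {G : SimpleGraph V} {H : SimpleGraph W} :
      (G ≃g H) → IsSubdivision G H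
  | step {V W U : Type} {G : SimpleGraph V} {H : SimpleGraph W} {u v : W}
      {H' : SimpleGraph U} :
      H.Adj u v → IsSubdivision G H → (subdivideEdge H u v ≃g H') → IsSubdivision G H'

/-- A Kuratowski subgraph of `G` is a subgraph that is a subdivision of `K₅` or `K_{3,3}`. -/
def IsKuratowski {V : Type} {G : SimpleGraph V} (H : G.Subgraph) : Prop :=
  IsSubdivision K5 H.coe ∨ IsSubdivision K33 H.coe

/-- A Kuratowski witness for `v` is a Kuratowski subgraph of `G` avoiding `v`. -/
def IsKuratowskiWitness {V : Type} (G : SimpleGraph V) (v : V) (H : G.Subgraph) : Prop :=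
  IsKuratowski H ∧ v ∉ H.verts

/-- A branch vertex of a (Kuratowski) subgraph: a vertex of degree at least 3 in it. -/
def IsBranchVertex {V : Type} {G : SimpleGraph V} (H : G.Subgraph) (x : V) : Prop :=
  x ∈ H.verts ∧ 3 ≤ (H.neighborSet x).ncard

/-- The vertex connectivity of a finite graph: the largest `k` such that deleting any
fewer than `k` vertices leaves a connected graph. -/
noncomputable def vConn {V : Type} [Fintype V] (G : SimpleGraph V) : ℕ :=
  sSup {k : ℕ | ∀ s : Finset V, s.card < k → (G.induce ((↑s : Set V)ᶜ)).Connected}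

/-- A 2-cut: a set of two vertices whose deletion disconnects the graph. -/
def IsTwoCut {V : Type} (G : SimpleGraph V) (S : Set V) : Prop :=
  S.ncard = 2 ∧ ¬ (G.induce Sᶜ).Preconnected

/-- `C` is (the vertex set of) a connected component of `G − S`. -/
def IsCompOf {V : Type} (G : SimpleGraph V) (S : Set V) (C : Set V) : Prop :=
  C.Nonempty ∧ Disjoint C S ∧ (G.induce C).Connected ∧
    ∀ u ∈ C, ∀ v, v ∉ S → G.Adj u v → v ∈ C

/-- The augmented component `C⁺`: the subgraph induced by `C ∪ S` together with all
edges joining vertices of `S`. -/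
def augment {V : Type} (G : SimpleGraph V) (S C : Set V) : SimpleGraph ↥(C ∪ S) :=
  SimpleGraph.fromRel (fun u v => G.Adj (u : V) (v : V) ∨ ((u : V) ∈ S ∧ (v : V) ∈ S))

/-- `C` is a heavy component for the 2-cut `{a,b}`: a component of `G − {a,b}` whose
augmentation contains Kuratowski witnesses for both `a` and `b`. -/
def IsHeavyComp {V : Type} (G : SimpleGraph V) (a b : V) (C : Set V) : Prop :=
  IsCompOf G {a, b} C ∧
    (∃ Ha : G.Subgraph, IsKuratowskiWitness G a Ha ∧ Ha.verts ⊆ C ∪ {a, b}) ∧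
    (∃ Hb : G.Subgraph, IsKuratowskiWitness G b Hb ∧ Hb.verts ⊆ C ∪ {a, b})

/-- `{a,b}` is a basic 2-cut with heavy component `C`: a 2-cut whose heavy-component
weight is minimum among all 2-cuts. -/
def IsBasic2Cut {V : Type} (G : SimpleGraph V) (a b : V) (C : Set V) : Prop :=
  IsTwoCut G {a, b} ∧ IsHeavyComp G a b C ∧
    ∀ c d : V, ∀ D : Set V, IsTwoCut G {c, d} → IsHeavyComp G c d D → C.ncard ≤ D.ncard

/-- The subgraph of `G` induced by `A`, kept on the same vertex set (vertices outside `A`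
become isolated). -/
def restrictTo {V : Type} (G : SimpleGraph V) (A : Set V) : SimpleGraph V :=
  SimpleGraph.fromRel (fun u v => G.Adj u v ∧ u ∈ A ∧ v ∈ A)

/-- Contract the edge `uv` of `G`, keeping the label `u` for the merged vertex
(`v` becomes isolated). -/
def contractEdge {V : Type} (G : SimpleGraph V) (u v : V) : SimpleGraph V :=
  SimpleGraph.fromRel (fun x y =>
    x ≠ v ∧ y ≠ v ∧ (G.Adj x y ∨ (x = u ∧ G.Adj v y) ∨ (y = u ∧ G.Adj x v)))

/-- `T` separates `a` from `b` in `G`: `a, b ∉ T` and every walk from `a` to `b`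
meets `T`. -/
def Separates {V : Type} (G : SimpleGraph V) (T : Set V) (a b : V) : Prop :=
  a ∉ T ∧ b ∉ T ∧ ∀ p : G.Walk a b, ∃ t ∈ T, t ∈ p.support

/-- Disjoint union of two graphs. -/
def disjUnion {V W : Type} (G : SimpleGraph V) (H : SimpleGraph W) : SimpleGraph (V ⊕ W) :=
  SimpleGraph.fromRel (fun x y =>
    (∃ a b, x = Sum.inl a ∧ y = Sum.inl b ∧ G.Adj a b) ∨
    (∃ a b, x = Sum.inr a ∧ y = Sum.inr b ∧ H.Adj a b))

/-- The graph on `Fin n` with the given list of edges. -/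
def graphOfList (n : ℕ) (l : List (ℕ × ℕ)) : SimpleGraph (Fin n) :=
  SimpleGraph.fromRel (fun i j => ((i : ℕ), (j : ℕ)) ∈ l)

/-- A graph is 2-connected: at least three vertices and no cut vertex. -/
def IsTwoConnectedGraph {U : Type} (H : SimpleGraph U) : Prop :=
  3 ≤ Nat.card U ∧ ∀ u : U, (H.induce {x | x ≠ u}).Connected


namespace SimpleGraph

/-- Connectedness of an induced subgraph in terms of sets closed under adjacency. -/
theorem connected_induce_iff_closed {V : Type} {G : SimpleGraph V} {S : Set V} :
    (G.induce S).Connected ↔ S.Nonempty ∧ ∀ C : Set V, (∃ p ∈ S, p ∈ C) →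
      (∀ a ∈ S, a ∈ C → ∀ b ∈ S, G.Adj a b → b ∈ C) → S ⊆ C := by
  constructor
  · intro h
    obtain ⟨s⟩ := h.nonempty
    refine ⟨⟨s, s.2⟩, ?_⟩
    rintro C ⟨p, hp, hpC⟩ hC q hq
    have hr := (reachable_iff_reflTransGen _ _).1 (h.preconnected ⟨p, hp⟩ ⟨q, hq⟩)
    have key : ∀ r : S, Relation.ReflTransGen (G.induce S).Adj ⟨p, hp⟩ r → r.1 ∈ C := by
      intro r hr
      induction hr with
      | refl => exact hpC
      | tail _ hbc ih => exact hC _ (Subtype.prop _) ih _ (Subtype.prop _) hbc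
    exact key _ hr
  · rintro ⟨⟨s, hs⟩, h⟩
    have : Nonempty S := ⟨⟨s, hs⟩⟩
    refine ⟨fun p q => ?_⟩
    have := h {q | ∃ hq : q ∈ S, (G.induce S).Reachable p ⟨q, hq⟩}
      ⟨p, p.2, p.2, Reachable.refl _⟩ (by
        rintro a _ ⟨ha, hr⟩ b hb hab
        refine ⟨hb, hr.trans (Adj.reachable ?_)⟩
        exact hab) q.2
    exact this.2

theorem IsMinorOf.of_injective_hom {U V W : Type} {K : SimpleGraph U} {A : SimpleGraph V}
    {B : SimpleGraph W} (h : K.IsMinorOf A) (φ : A →g B) (hφ : Function.Injective φ) :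
    K.IsMinorOf B := by
  obtain ⟨f, hc, hd, he⟩ := h
  refine ⟨fun k => φ '' f k, fun k => ?_, fun k l hkl => ?_, fun k l hkl => ?_⟩
  · obtain ⟨hne, hcl⟩ := connected_induce_iff_closed.1 (hc k)
    refine connected_induce_iff_closed.2 ⟨hne.image _, ?_⟩
    rintro C ⟨_, ⟨p, hp, rfl⟩, hpC⟩ hC
    rw [Set.image_subset_iff]
    exact hcl _ ⟨p, hp, hpC⟩ fun a ha haC b hb hab =>
      hC _ ⟨a, ha, rfl⟩ haC _ ⟨b, hb, rfl⟩ (φ.map_adj hab)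
  · exact (Set.disjoint_image_iff hφ).2 (hd hkl)
  · obtain ⟨a, ha, b, hb, hab⟩ := he hkl
    exact ⟨_, ⟨a, ha, rfl⟩, _, ⟨b, hb, rfl⟩, φ.map_adj hab⟩

theorem IsMinorOf.refl {V : Type} (G : SimpleGraph V) : G.IsMinorOf G := by
  refine ⟨fun v => {v}, fun v => ?_, fun v w h => ?_, fun v w h => ⟨v, rfl, w, rfl, h⟩⟩
  · refine connected_induce_iff_closed.2 ⟨⟨v, rfl⟩, ?_⟩
    rintro C ⟨p, rfl, hp⟩ _ q rfl
    exact hp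
  · exact Set.disjoint_singleton.2 h

theorem subdivideEdge_adj_some_some {V : Type} {G : SimpleGraph V} {u v a b : V} :
    (subdivideEdge G u v).Adj (some a) (some b) ↔ G.Adj a b ∧ s(a, b) ≠ s(u, v) := by
  simp only [subdivideEdge, fromRel_adj]
  constructor
  · rintro ⟨-, (⟨a, b, ha, hb, h⟩ | h) | (⟨a, b, ha, hb, h, h'⟩ | h)⟩
    · cases ha; cases hb; exact h
    · simp at h
    · cases ha; cases hb; exact ⟨h.symm, by rwa [Sym2.eq_swap]⟩
    · simp at h
  · rintro ⟨h, h'⟩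
    exact ⟨by simpa using h.ne, Or.inl (Or.inl ⟨a, b, rfl, rfl, h, h'⟩)⟩

theorem subdivideEdge_adj_none_some {V : Type} {G : SimpleGraph V} {u v a : V} :
    (subdivideEdge G u v).Adj none (some a) ↔ a = u ∨ a = v := by
  simp [subdivideEdge, fromRel_adj]

theorem IsMinorOf.subdivideEdge {U V : Type} {K : SimpleGraph U} {H : SimpleGraph V}
    (h : K.IsMinorOf H) (u v : V) : K.IsMinorOf (subdivideEdge H u v) := by
  obtain ⟨f, hc, hd, he⟩ := h
  have hmem : ∀ {a k l}, a ∈ f k → a ∈ f l → k = l := fun {a k l} hk hl => by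
    by_contra hne
    exact Set.disjoint_left.1 (hd hne) hk hl
  refine ⟨fun k => {p | p.elim (u ∈ f k) (· ∈ f k)}, fun k => ?_, fun k l hkl => ?_,
    fun k l hkl => ?_⟩
  · obtain ⟨⟨s, hs⟩, hcl⟩ := connected_induce_iff_closed.1 (hc k)
    refine connected_induce_iff_closed.2 ⟨⟨some s, hs⟩, ?_⟩
    rintro C ⟨p, hp, hpC⟩ hC
    have hsome : ∀ a ∈ f k, some a ∈ C := by
      refine fun a ha => hcl {a | some a ∈ C} ?_ ?_ ha
      · cases p with
        | none => exact ⟨u, hp, hC _ hp hpC (some u) hp (subdivideEdge_adj_none_some.2 (.inl rfl))⟩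
        | some p => exact ⟨p, hp, hpC⟩
      · intro a ha haC b hb hab
        by_cases hs : s(a, b) = s(u, v)
        · have huk : u ∈ f k := by
            rcases Sym2.eq_iff.1 hs with ⟨rfl, -⟩ | ⟨-, rfl⟩ <;> assumption
          have hau : a = u ∨ a = v := by rcases Sym2.eq_iff.1 hs with h | h <;> simp [h]
          have hbu : b = u ∨ b = v := by rcases Sym2.eq_iff.1 hs with h | h <;> simp [h]
          have hn := hC (some a) ha haC none huk (subdivideEdge_adj_none_some.2 hau).symm
          exact hC none huk hn (some b) hb (subdivideEdge_adj_none_some.2 hbu)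
        · exact hC (some a) ha haC (some b) hb (subdivideEdge_adj_some_some.2 ⟨hab, hs⟩)
    rintro (_ | q) hq
    · exact hC (some u) hq (hsome u hq) none hq (subdivideEdge_adj_none_some.2 (.inl rfl)).symm
    · exact hsome q hq
  · refine Set.disjoint_left.2 ?_
    rintro (_ | q) hk hl
    · exact hkl (hmem hk hl)
    · exact hkl (hmem hk hl)
  · obtain ⟨a, ha, b, hb, hab⟩ := he hkl
    by_cases hs : s(a, b) = s(u, v)
    · rcases Sym2.eq_iff.1 hs with ⟨rfl, rfl⟩ | ⟨rfl, rfl⟩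
      · exact ⟨none, ha, some b, hb, subdivideEdge_adj_none_some.2 (.inr rfl)⟩
      · exact ⟨some a, ha, none, hb, (subdivideEdge_adj_none_some.2 (.inr rfl)).symm⟩
    · exact ⟨some a, ha, some b, hb, subdivideEdge_adj_some_some.2 ⟨hab, hs⟩⟩

end SimpleGraph

theorem IsSubdivision.isMinorOf {V W : Type} {G : SimpleGraph V} {H : SimpleGraph W}
    (h : IsSubdivision G H) : G.IsMinorOf H := by
  induction h with
  | of_iso e => exact (IsMinorOf.refl _).of_injective_hom e.toHom e.injective
  | step _ _ e ih => exact (ih.subdivideEdge _ _).of_injective_hom e.toHom e.injective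

/-- At least three vertices, and deleting at most one vertex leaves any two remaining vertices
connected; connectedness is expressed through sets closed under adjacency. -/
def IsTwoConnClosed {V : Type} (H : SimpleGraph V) : Prop :=
  (∀ u v : V, ∃ w, w ≠ u ∧ w ≠ v) ∧
    ∀ T : Set V, T.Subsingleton → ∀ C : Set V, (∃ p ∈ C, p ∉ T) →
      (∀ a ∈ C, a ∉ T → ∀ b, b ∉ T → H.Adj a b → b ∈ C) → ∀ q, q ∉ T → q ∈ C

theorem IsTwoConnClosed.of_iso {V W : Type} {G : SimpleGraph V} {H : SimpleGraph W}
    (h : IsTwoConnClosed G) (e : G ≃g H) : IsTwoConnClosed H := by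
  refine ⟨fun u v => ?_, ?_⟩
  · obtain ⟨w, h1, h2⟩ := h.1 (e.symm u) (e.symm v)
    refine ⟨e w, ?_, ?_⟩
    · rintro rfl; simp at h1
    · rintro rfl; simp at h2
  · rintro T hT C ⟨p, hp, hpT⟩ hC q hq
    have := h.2 (e ⁻¹' T) (hT.preimage e.injective) (e ⁻¹' C)
      ⟨e.symm p, by simpa using hp, by simpa using hpT⟩
      (fun a ha haT b hb hab => hC _ ha haT _ hb (e.map_adj_iff.2 hab)) (e.symm q) (by simpa using hq)
    simpa using this

theorem IsTwoConnClosed.subdivideEdge {V : Type} {H : SimpleGraph V} (h : IsTwoConnClosed H)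
    {u v : V} (huv : H.Adj u v) : IsTwoConnClosed (subdivideEdge H u v) := by
  refine ⟨fun a b => ?_, ?_⟩
  · obtain ⟨w, hwu, hwv⟩ := h.1 u v
    have huv := huv.ne
    by_contra! hab
    have h1 := hab (some u)
    have h2 := hab (some v)
    have h3 := hab (some w)
    have huv' : some u ≠ some v := by simpa
    have hwu' : some w ≠ some u := by simpa
    have hwv' : some w ≠ some v := by simpa
    by_cases hau : some u = a
    · exact hwv' ((h3 (hau ▸ hwu')).trans (h2 (hau ▸ huv'.symm)).symm)
    · by_cases hav : some v = a
      · exact hwu' ((h3 (hav ▸ hwv')).trans (h1 hau).symm)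
      · exact huv' ((h1 hau).trans (h2 hav).symm)
  rintro T hT C ⟨p, hp, hpT⟩ hC
  have hadj : ∀ a b, some a ∈ C → some a ∉ T → some b ∉ T → H.Adj a b → s(a, b) ≠ s(u, v) →
      some b ∈ C := fun a b ha haT hbT hab hs =>
    hC _ ha haT _ hbT (subdivideEdge_adj_some_some.2 ⟨hab, hs⟩)
  by_cases hn : none ∈ T
  · have hTn : ∀ a, some a ∉ T := fun a ha => by cases hT ha hn
    obtain ⟨w, hwu, hwv⟩ := h.1 u v
    have avoid : ∀ x, x = u ∨ x = v → (∃ p, some p ∈ C ∧ p ≠ x) → ∀ q, q ≠ x → some q ∈ C := by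
      rintro x hx ⟨p, hp, hpx⟩ q hq
      refine h.2 {x} Set.subsingleton_singleton {a | some a ∈ C} ⟨p, hp, hpx⟩ ?_ q hq
      intro a ha hax b hbx hab
      refine hadj a b ha (hTn _) (hTn _) hab fun hs => ?_
      simp only [Set.mem_singleton_iff] at hax hbx
      rcases Sym2.eq_iff.1 hs with ⟨rfl, rfl⟩ | ⟨rfl, rfl⟩ <;> rcases hx with rfl | rfl <;> simp_all
    have hw : some w ∈ C := by
      cases p with
      | none => exact absurd hn hpT
      | some p =>
        by_cases hpu : p = u
        · exact avoid v (.inr rfl) ⟨p, hp, hpu ▸ huv.ne⟩ w hwv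
        · exact avoid u (.inl rfl) ⟨p, hp, hpu⟩ w hwu
    rintro (_ | q) hq
    · exact absurd hn hq
    · by_cases hqu : q = u
      · exact avoid v (.inr rfl) ⟨w, hw, hwv⟩ q (hqu ▸ huv.ne)
      · exact avoid u (.inl rfl) ⟨w, hw, hwu⟩ q hqu
  · obtain ⟨x, hx, hxT⟩ : ∃ x, (x = u ∨ x = v) ∧ some x ∉ T := by
      by_contra! hcon
      have := hT (hcon u (.inl rfl)) (hcon v (.inr rfl))
      exact huv.ne (Option.some.inj this)
    have hsome : ∀ q, some q ∉ T → some q ∈ C := by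
      refine h.2 (some ⁻¹' T) (hT.preimage (Option.some_injective _)) {a | some a ∈ C} ?_ ?_
      · cases p with
        | none => exact ⟨x, hC _ hp hn _ hxT (subdivideEdge_adj_none_some.2 hx), hxT⟩
        | some p => exact ⟨p, hp, hpT⟩
      · intro a ha haT b hbT hab
        by_cases hs : s(a, b) = s(u, v)
        · have hau : a = u ∨ a = v := by rcases Sym2.eq_iff.1 hs with h | h <;> simp [h]
          have hbu : b = u ∨ b = v := by rcases Sym2.eq_iff.1 hs with h | h <;> simp [h]
          exact hC _ (hC _ ha haT none hn (subdivideEdge_adj_none_some.2 hau).symm) hn _ hbT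
            (subdivideEdge_adj_none_some.2 hbu)
        · exact hadj a b ha haT hbT hab hs
    rintro (_ | q) hq
    · exact hC _ (hsome x hxT) hxT _ hn (subdivideEdge_adj_none_some.2 hx).symm
    · exact hsome q hq

theorem IsSubdivision.isTwoConnClosed {V W : Type} {G : SimpleGraph V} {H : SimpleGraph W}
    (h : IsSubdivision G H) (hG : IsTwoConnClosed G) : IsTwoConnClosed H := by
  induction h with
  | of_iso e => exact hG.of_iso e
  | step huv _ e ih => exact ((ih hG).subdivideEdge huv).of_iso e

theorem K5_adj {i j : Fin 5} : K5.Adj i j ↔ i ≠ j := Iff.rfl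

theorem K33_adj {i j : Fin 6} :
    K33.Adj i j ↔ (i.val < 3 ∧ 3 ≤ j.val) ∨ (j.val < 3 ∧ 3 ≤ i.val) := by
  simp only [K33, fromRel_adj, ne_eq, and_iff_right_iff_imp]
  rintro h rfl
  omega

theorem isTwoConnClosed_of_common_neighbors {V : Type} {H : SimpleGraph V}
    (h : ∀ u v : V, ∃ w, w ≠ u ∧ w ≠ v)
    (hH : ∀ p q t : V, p = q ∨ H.Adj p q ∨ ∃ r, r ≠ t ∧ H.Adj p r ∧ H.Adj r q) :
    IsTwoConnClosed H := by
  refine ⟨h, ?_⟩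
  rintro T hT C ⟨p, hp, hpT⟩ hC q hq
  obtain ⟨t, ht⟩ : ∃ t, ∀ r ∈ T, r = t := by
    rcases hT.eq_empty_or_singleton with rfl | ⟨t, rfl⟩
    · exact ⟨p, by simp⟩
    · exact ⟨t, by simp⟩
  rcases hH p q t with rfl | hpq | ⟨r, hrt, hpr, hrq⟩
  · exact hp
  · exact hC p hp hpT q hq hpq
  · have hrT : r ∉ T := fun hr => hrt (ht r hr)
    exact hC r (hC p hp hpT r hrT hpr) hrT q hq hrq

theorem isTwoConnClosed_K5 : IsTwoConnClosed K5 := by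
  refine isTwoConnClosed_of_common_neighbors (by decide) fun p q _ => ?_
  by_cases h : p = q
  · exact .inl h
  · exact .inr (.inl h)

theorem isTwoConnClosed_K33 : IsTwoConnClosed K33 := by
  refine isTwoConnClosed_of_common_neighbors (by decide) ?_
  simp only [K33_adj]
  decide

theorem exists_adj_K5 (i j l : Fin 5) : ∃ k, K5.Adj i k ∧ k ≠ j ∧ k ≠ l := by
  simp only [K5_adj]
  revert i j l
  decide

theorem exists_adj_K33 (i j l : Fin 6) : ∃ k, K33.Adj i k ∧ k ≠ j ∧ k ≠ l := by
  simp only [K33_adj]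
  revert i j l
  decide

namespace SimpleGraph

/-- Contract `x` into `y`; the vertex `x` is removed. -/
def contractInto {V : Type} (A : SimpleGraph V) (x y : V) : SimpleGraph {q : V // q ≠ x} where
  Adj p q := p ≠ q ∧ (A.Adj p q ∨ (p.1 = y ∧ A.Adj x q) ∨ (q.1 = y ∧ A.Adj x p))
  symm := ⟨fun p q h => ⟨h.1.symm, by
    rcases h.2 with h | h | h
    · exact .inl h.symm
    · exact .inr (.inr h)
    · exact .inr (.inl h)⟩⟩
  loopless := ⟨fun p h => h.1 rfl⟩

theorem contractInto_isMinorOf {V : Type} {A : SimpleGraph V} {x y : V} (hxy : A.Adj x y) :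
    (A.contractInto x y).IsMinorOf A := by
  refine ⟨fun p => {q | q = p ∨ (q = x ∧ p.1 = y)}, fun p => ?_, fun p q hpq => ?_,
    fun p q hpq => ?_⟩
  · refine connected_induce_iff_closed.2 ⟨⟨p, .inl rfl⟩, ?_⟩
    rintro C ⟨a, ha, haC⟩ hC
    have hp : p.1 ∈ C := by
      rcases ha with rfl | ⟨rfl, hp⟩
      · exact haC
      · exact hC _ (.inr ⟨rfl, hp⟩) haC _ (.inl rfl) (hp ▸ hxy)
    rintro b (rfl | ⟨rfl, h⟩)
    · exact hp
    · exact hC _ (.inl rfl) hp _ (.inr ⟨rfl, h⟩) (h ▸ hxy.symm)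
  · refine Set.disjoint_left.2 ?_
    rintro a (rfl | ⟨rfl, hp⟩) (h | ⟨h, hq⟩)
    · exact hpq (Subtype.ext h)
    · exact p.2 h
    · exact q.2 h.symm
    · exact hpq (Subtype.ext (hp.trans hq.symm))
  · rcases hpq.2 with h | ⟨h, h'⟩ | ⟨h, h'⟩
    · exact ⟨p, .inl rfl, q, .inl rfl, h⟩
    · exact ⟨x, .inr ⟨rfl, h⟩, q, .inl rfl, h'⟩
    · exact ⟨p, .inl rfl, x, .inr ⟨rfl, h⟩, h'.symm⟩

/-- Contracting an edge at a vertex of degree at most two preserves minors of minimum degree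
at least three. -/
theorem IsMinorOf.contractInto {U V : Type} {K : SimpleGraph U} {A : SimpleGraph V}
    (h : K.IsMinorOf A) (hK : ∀ i j l, ∃ k, K.Adj i k ∧ k ≠ j ∧ k ≠ l) {x y b : V}
    (hxy : A.Adj x y) (hx : ∀ c, A.Adj x c → c = y ∨ c = b) :
    K.IsMinorOf (A.contractInto x y) := by
  classical
  obtain ⟨f, hc, hd, he⟩ := h
  have hmem : ∀ {a k l}, a ∈ f k → a ∈ f l → k = l := fun {a k l} hk hl => by
    by_contra hne
    exact Set.disjoint_left.1 (hd hne) hk hl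
  by_cases hsplit : ∃ i j, i ≠ j ∧ x ∈ f i ∧ y ∈ f j
  · obtain ⟨i, j, hij, hxi, hyj⟩ := hsplit
    have hxb : b ∈ f i ∧ A.Adj x b := by
      by_contra hb
      have hfx : f i ⊆ {x} := by
        refine (connected_induce_iff_closed.1 (hc i)).2 {x} ⟨x, hxi, rfl⟩ ?_
        rintro a - rfl c hci hac
        rcases hx c hac with rfl | rfl
        · exact absurd (hmem hci hyj) hij
        · exact absurd ⟨hci, hac⟩ hb
      obtain ⟨l, hl⟩ : ∃ l, ∀ k, b ∈ f k → k = l := by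
        by_cases hbl : ∃ l, b ∈ f l
        · exact ⟨hbl.choose, fun k hk => hmem hk hbl.choose_spec⟩
        · exact ⟨i, fun k hk => absurd ⟨k, hk⟩ hbl⟩
      obtain ⟨k, hik, hkj, hkl⟩ := hK i j l
      obtain ⟨a, ha, c, hck, hac⟩ := he hik
      obtain rfl : a = x := hfx ha
      rcases hx c hac with rfl | rfl
      · exact hkj (hmem hck hyj)
      · exact hkl (hl k hck)
    obtain ⟨hbi, hxb⟩ := hxb
    have hby : b ≠ y := fun hby => hij (hmem hbi (hby ▸ hyj))
    have hyb : (A.contractInto x y).Adj ⟨y, hxy.ne'⟩ ⟨b, hxb.ne'⟩ :=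
      ⟨fun h => hby (congrArg Subtype.val h).symm, .inr (.inl ⟨rfl, hxb⟩)⟩
    refine ⟨fun k => {p | p.1 ∈ f k}, fun k => ?_, fun k l hkl => ?_, fun k l hkl => ?_⟩
    · obtain ⟨⟨s, hs⟩, hcl⟩ := connected_induce_iff_closed.1 (hc k)
      refine connected_induce_iff_closed.2 ⟨?_, ?_⟩
      · by_cases hsx : s = x
        · exact ⟨⟨b, hxb.ne'⟩, hmem hxi (hsx ▸ hs) ▸ hbi⟩
        · exact ⟨⟨s, hsx⟩, hs⟩
      · rintro C ⟨p, hp, hpC⟩ hC q hq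
        have hq' := hcl {a | ∃ r ∈ C, r.1 = if a = x then b else a}
          ⟨p, hp, p, hpC, by simp [p.2]⟩ ?_ hq
        · obtain ⟨r, hr, hrq⟩ := hq'
          rw [if_neg q.2] at hrq
          rwa [Subtype.ext hrq] at hr
        · rintro a hak ⟨r, hrC, hra⟩ c hck hac
          have hxk : ∀ d ∈ f k, x ∈ f k → A.Adj x d → d = b := fun d hd hxk hxd =>
            (hx d hxd).resolve_left fun hdy => hij ((hmem hxi hxk).trans (hmem (hdy ▸ hd) hyj))
          by_cases hax : a = x
          · subst hax
            obtain rfl := hxk c hck hak hac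
            exact ⟨r, hrC, by simpa [hac.ne'] using hra⟩
          · by_cases hcx : c = x
            · subst hcx
              obtain rfl := hxk a hak hck hac.symm
              exact ⟨r, hrC, by simpa [hax] using hra⟩
            · rw [if_neg hax] at hra
              refine ⟨⟨c, hcx⟩, hC r (by simpa [hra] using hak) hrC ⟨c, hcx⟩ hck ⟨?_, .inl ?_⟩,
                by simp [hcx]⟩
              · rintro rfl
                exact hac.ne hra.symm
              · rwa [hra]
    · refine Set.disjoint_left.2 ?_
      exact fun p hk hl => hkl (hmem hk hl)
    · obtain ⟨a, ha, c, hcl, hac⟩ := he hkl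
      by_cases hax : a = x
      · subst hax
        obtain rfl := hmem ha hxi
        rcases hx c hac with rfl | rfl
        · exact ⟨_, hbi, _, hcl, hyb.symm⟩
        · exact absurd (hmem hbi hcl) hkl.ne
      · by_cases hcx : c = x
        · subst hcx
          obtain rfl := hmem hcl hxi
          rcases hx a hac.symm with rfl | rfl
          · exact ⟨_, ha, _, hbi, hyb⟩
          · exact absurd (hmem ha hbi) hkl.ne
        · exact ⟨⟨a, hax⟩, ha, ⟨c, hcx⟩, hcl, fun h => hac.ne (congrArg Subtype.val h), .inl hac⟩
  · let π : V → {q : V // q ≠ x} := fun a => if h : a = x then ⟨y, hxy.ne'⟩ else ⟨a, h⟩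
    have hπx : π x = ⟨y, hxy.ne'⟩ := by simp [π]
    have hπ : ∀ a (h : a ≠ x), π a = ⟨a, h⟩ := fun a h => by simp [π, h]
    have hπadj : ∀ a c, A.Adj a c → π a = π c ∨ (A.contractInto x y).Adj (π a) (π c) := by
      intro a c hac
      by_cases heq : π a = π c
      · exact .inl heq
      refine .inr ⟨heq, ?_⟩
      by_cases hax : a = x
      · subst hax
        rw [hπx, hπ c hac.ne']
        exact .inr (.inl ⟨rfl, hac⟩)
      · by_cases hcx : c = x
        · subst hcx
          rw [hπx, hπ a hax]
          exact .inr (.inr ⟨rfl, hac.symm⟩)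
        · rw [hπ a hax, hπ c hcx]
          exact .inl hac
    have hπmem : ∀ {a c k l}, a ∈ f k → c ∈ f l → π a = π c → k = l := by
      intro a c k l ha hcl hac
      by_cases hax : a = x
      · subst hax
        by_cases hcx : c = a
        · exact hmem ha (hcx ▸ hcl)
        · rw [hπx, hπ c hcx] at hac
          have hcy : y = c := congrArg Subtype.val hac
          by_contra hkl
          exact hsplit ⟨k, l, hkl, ha, hcy ▸ hcl⟩
      · by_cases hcx : c = x
        · subst hcx
          rw [hπx, hπ a hax] at hac
          have hay : a = y := congrArg Subtype.val hac
          by_contra hkl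
          exact hsplit ⟨l, k, Ne.symm hkl, hcl, hay ▸ ha⟩
        · rw [hπ a hax, hπ c hcx] at hac
          have hac : a = c := congrArg Subtype.val hac
          exact hmem ha (hac ▸ hcl)
    refine ⟨fun k => π '' f k, fun k => ?_, fun k l hkl => ?_, fun k l hkl => ?_⟩
    · obtain ⟨hne, hcl⟩ := connected_induce_iff_closed.1 (hc k)
      refine connected_induce_iff_closed.2 ⟨hne.image _, ?_⟩
      rintro C ⟨_, ⟨p, hp, rfl⟩, hpC⟩ hC
      rw [Set.image_subset_iff]
      refine hcl _ ⟨p, hp, hpC⟩ fun a ha haC c hck hac => ?_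
      rcases hπadj a c hac with h | h
      · rw [Set.mem_preimage, ← h]
        exact haC
      · exact hC _ ⟨a, ha, rfl⟩ haC _ ⟨c, hck, rfl⟩ h
    · refine Set.disjoint_left.2 ?_
      rintro _ ⟨a, ha, rfl⟩ ⟨c, hcl, hac⟩
      exact hkl (hπmem ha hcl hac.symm)
    · obtain ⟨a, ha, c, hcl, hac⟩ := he hkl
      exact ⟨_, ⟨a, ha, rfl⟩, _, ⟨c, hcl, rfl⟩,
        (hπadj a c hac).resolve_left fun h => hkl.ne (hπmem ha hcl h)⟩

end SimpleGraph

theorem IsKuratowski.not_isPlanar {V W : Type} {G : SimpleGraph V} {H : G.Subgraph}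
    (hH : IsKuratowski H) {B : SimpleGraph W} (φ : H.coe →g B) (hφ : Function.Injective φ) :
    ¬ IsPlanar B := fun hB =>
  hH.elim (fun h => hB.1 (h.isMinorOf.of_injective_hom φ hφ))
    fun h => hB.2 (h.isMinorOf.of_injective_hom φ hφ)

theorem IsKuratowski.not_isPlanar_of_contractInto {V W : Type} {G : SimpleGraph V}
    {H : G.Subgraph} (hH : IsKuratowski H) {x y b : H.verts} (hxy : H.coe.Adj x y)
    (hx : ∀ c, H.coe.Adj x c → c = y ∨ c = b) {B : SimpleGraph W}
    (φ : H.coe.contractInto x y →g B) (hφ : Function.Injective φ) : ¬ IsPlanar B := fun hB =>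
  hH.elim
    (fun h => hB.1 ((h.isMinorOf.contractInto exists_adj_K5 hxy hx).of_injective_hom φ hφ))
    fun h => hB.2 ((h.isMinorOf.contractInto exists_adj_K33 hxy hx).of_injective_hom φ hφ)

theorem IsKuratowski.isTwoConnClosed {V : Type} {G : SimpleGraph V} {H : G.Subgraph}
    (hH : IsKuratowski H) : IsTwoConnClosed H.coe :=
  hH.elim (·.isTwoConnClosed isTwoConnClosed_K5) (·.isTwoConnClosed isTwoConnClosed_K33)

theorem IsKuratowski.exists_mem_verts_ne {V : Type} {G : SimpleGraph V} {H : G.Subgraph}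
    (hH : IsKuratowski H) (t : V) : ∃ p ∈ H.verts, p ≠ t := by
  have hne : Nonempty H.verts := by
    rcases hH with h | h
    · obtain ⟨f, hf, -⟩ := h.isMinorOf
      exact (hf 0).nonempty.map Subtype.val
    · obtain ⟨f, hf, -⟩ := h.isMinorOf
      exact (hf 0).nonempty.map Subtype.val
  obtain ⟨p⟩ := hne
  obtain ⟨q, hq, -⟩ := hH.isTwoConnClosed.1 p p
  by_cases hp : p.1 = t
  · exact ⟨q, q.2, fun h => hq (Subtype.ext (h.trans hp.symm))⟩
  · exact ⟨p, p.2, hp⟩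

theorem connected_of_vConn_pos {V : Type} [Fintype V] {G : SimpleGraph V} (h : 0 < vConn G) :
    (G.induce (Set.univ : Set V)).Connected := by
  unfold vConn at h
  have hne : {k : ℕ | ∀ s : Finset V, s.card < k → (G.induce ((↑s : Set V)ᶜ)).Connected}.Nonempty := by
    by_contra hne
    rw [Set.not_nonempty_iff_eq_empty] at hne
    simp [hne] at h
  obtain ⟨k, hk, hk0⟩ := exists_lt_of_lt_csSup hne h
  have := hk ∅ (by simpa using hk0)
  rwa [Finset.coe_empty, Set.compl_empty] at this

/-- In an apex obstruction, three Kuratowski subgraphs without a common vertex cover all edges. -/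
theorem IsApexObstruction.edgeSet_eq {V : Type} [Fintype V] {G : SimpleGraph V}
    (hG : IsApexObstruction G) {H₁ H₂ H₃ : G.Subgraph} (h₁ : IsKuratowski H₁)
    (h₂ : IsKuratowski H₂) (h₃ : IsKuratowski H₃)
    (hdisj : H₁.verts ∩ H₂.verts ∩ H₃.verts = ∅) :
    G.edgeSet = H₁.edgeSet ∪ H₂.edgeSet ∪ H₃.edgeSet := by
  let L : SimpleGraph V := (H₁ ⊔ H₂ ⊔ H₃).spanningCoe
  have hLG : L ≤ G := Subgraph.spanningCoe_le _
  have hdel : ∀ (H : G.Subgraph), IsKuratowski H → H ≤ H₁ ⊔ H₂ ⊔ H₃ → ∀ z, z ∉ H.verts →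
      ¬ IsPlanar (L.induce {u | u ≠ z}) := by
    intro H hH hle z hz
    refine hH.not_isPlanar ⟨fun p => ⟨p.1, fun h => hz (h ▸ p.2)⟩, fun h => hle.2 h⟩ fun p q h => ?_
    exact Subtype.ext (congrArg (fun r => r.1) h)
  have hL : ¬ IsApex L := by
    rintro (h | ⟨z, hz⟩)
    · exact h₁.not_isPlanar ⟨Subtype.val, fun h => (le_sup_left.trans le_sup_left : H₁ ≤ _).2 h⟩
        Subtype.val_injective h
    · by_cases hz₁ : z ∈ H₁.verts
      · by_cases hz₂ : z ∈ H₂.verts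
        · refine hdel H₃ h₃ le_sup_right z (fun hz₃ => ?_) hz
          exact (hdisj ▸ ⟨⟨hz₁, hz₂⟩, hz₃⟩ : z ∈ (∅ : Set V))
        · exact hdel H₂ h₂ (le_sup_right.trans le_sup_left) z hz₂ hz
      · exact hdel H₁ h₁ (le_sup_left.trans le_sup_left) z hz₁ hz
  have hiso : Nonempty (L ≃g G) := by
    by_contra hiso
    exact hL (hG.2 V L ((IsMinorOf.refl L).of_injective_hom (Hom.ofLE hLG) Function.injective_id)
      (not_nonempty_iff.1 hiso))
  obtain ⟨e⟩ := hiso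
  have hcard : G.edgeSet.ncard ≤ L.edgeSet.ncard := by
    rw [← Nat.card_coe_set_eq, ← Nat.card_coe_set_eq, Nat.card_congr e.mapEdgeSet]
  rw [← Set.eq_of_subset_of_ncard_le (edgeSet_mono hLG) hcard (Set.toFinite _)]
  ext ⟨a, b⟩
  simp [L]

theorem IsApexObstruction.isBranchVertex {V : Type} [Fintype V] {G : SimpleGraph V}
    (hG : IsApexObstruction G) {H₁ H₂ H₃ : G.Subgraph} (h₁ : IsKuratowski H₁)
    (h₂ : IsKuratowski H₂) (h₃ : IsKuratowski H₃)
    (hdisj : H₁.verts ∩ H₂.verts ∩ H₃.verts = ∅) {x y : V} (hxy : H₁.Adj x y)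
    (hx₂ : x ∉ H₂.verts) (hx₃ : x ∉ H₃.verts) : IsBranchVertex H₁ x := by
  refine ⟨H₁.edge_vert hxy, ?_⟩
  by_contra! hdeg
  obtain ⟨b, hbv, hb⟩ : ∃ b ∈ H₁.verts, ∀ c, H₁.Adj x c → c = y ∨ c = b := by
    by_contra! hcon
    obtain ⟨c, hc, hcy, -⟩ := hcon y hxy.snd_mem
    obtain ⟨d, hd, hdy, hdc⟩ := hcon c hc.snd_mem
    have hsub : ({y, c, d} : Set V) ⊆ H₁.neighborSet x := by
      rintro a (rfl | rfl | rfl) <;> assumption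
    have := Set.ncard_le_ncard hsub (Set.toFinite _)
    rw [Set.ncard_eq_three.2 ⟨y, c, d, hcy.symm, hdy.symm, hdc.symm, rfl⟩] at this
    omega
  let G' := G.contractInto x y
  have hcon : ∀ (W : Type) (B : SimpleGraph W)
      (φ : H₁.coe.contractInto ⟨x, H₁.edge_vert hxy⟩ ⟨y, hxy.snd_mem⟩ →g B),
      Function.Injective φ → ¬ IsPlanar B := fun W B φ hφ =>
    h₁.not_isPlanar_of_contractInto (b := ⟨b, hbv⟩) (by exact hxy)
      (fun c hc => (hb c (by exact hc)).imp (fun h => Subtype.ext h) fun h => Subtype.ext h) φ hφ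
  have hadj : ∀ p q : {q : H₁.verts // q ≠ ⟨x, H₁.edge_vert hxy⟩},
      (H₁.coe.contractInto ⟨x, H₁.edge_vert hxy⟩ ⟨y, hxy.snd_mem⟩).Adj p q →
      G'.Adj ⟨p.1.1, fun h => p.2 (Subtype.ext h)⟩ ⟨q.1.1, fun h => q.2 (Subtype.ext h)⟩ := by
    rintro p q ⟨hne, h⟩
    refine ⟨fun h => hne (Subtype.ext (Subtype.ext (congrArg (fun r => r.1) h))), ?_⟩
    rcases h with h | ⟨h, h'⟩ | ⟨h, h'⟩
    · exact .inl (H₁.adj_sub h)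
    · exact .inr (.inl ⟨congrArg Subtype.val h, H₁.adj_sub h'⟩)
    · exact .inr (.inr ⟨congrArg Subtype.val h, H₁.adj_sub h'⟩)
  have hdel : ∀ H : G.Subgraph, IsKuratowski H → x ∉ H.verts → ∀ z : {q : V // q ≠ x},
      z.1 ∉ H.verts → ¬ IsPlanar (G'.induce {u | u ≠ z}) := by
    intro H hH hx z hz
    refine hH.not_isPlanar ⟨fun p => ⟨⟨p.1, fun h => hx (h ▸ p.2)⟩, fun h =>
      hz (congrArg Subtype.val h ▸ p.2)⟩, fun {p q} h => ?_⟩ fun p q h => ?_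
    · exact ⟨fun heq => h.ne (Subtype.ext (congrArg (fun r => r.1) heq)), .inl (H.adj_sub h)⟩
    · exact Subtype.ext (congrArg (fun r => r.1.1) h)
  have hG' : ¬ IsApex G' := by
    rintro (h | ⟨z, hz⟩)
    · refine hcon _ _ ⟨_, fun {p q} h => hadj p q h⟩ (fun p q h => ?_) h
      exact Subtype.ext (Subtype.ext (congrArg (fun r => r.1) h))
    · by_cases hz₂ : z.1 ∈ H₂.verts
      · by_cases hz₃ : z.1 ∈ H₃.verts
        · have hz₁ : z.1 ∉ H₁.verts := fun hz₁ =>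
            (hdisj ▸ ⟨⟨hz₁, hz₂⟩, hz₃⟩ : z.1 ∈ (∅ : Set V))
          refine hcon _ _ ⟨fun p => ⟨⟨p.1.1, fun h => p.2 (Subtype.ext h)⟩, fun h =>
            hz₁ (congrArg Subtype.val h ▸ p.1.2)⟩, fun {p q} h => hadj p q h⟩ (fun p q h => ?_) hz
          exact Subtype.ext (Subtype.ext (congrArg (fun r => r.1.1) h))
        · exact hdel H₃ h₃ hx₃ z hz₃ hz
      · exact hdel H₂ h₂ hx₂ z hz₂ hz
  refine hG' (hG.2 _ G' (contractInto_isMinorOf (H₁.adj_sub hxy)) ⟨fun e => ?_⟩)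
  have := Finite.card_subtype_lt (p := fun q : V => q ≠ x) (x := x) (by simp)
  exact this.ne (Nat.card_congr e.toEquiv)

/-- A Kuratowski subgraph avoiding one vertex of a 2-cut meets only one component. -/
theorem IsKuratowskiWitness.exists_isCompOf {V : Type} {G : SimpleGraph V} {S : Set V}
    (hS : IsTwoCut G S) {s : V} (hs : s ∈ S) {H : G.Subgraph} (hH : IsKuratowskiWitness G s H) :
    ∃ C : Set V, IsCompOf G S C ∧ H.verts ⊆ C ∪ S := by
  obtain ⟨t, ht⟩ : ∃ t, ∀ r ∈ S, r ∈ H.verts → r = t := by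
    obtain ⟨a, b, -, rfl⟩ := Set.ncard_eq_two.1 hS.1
    rcases hs with rfl | rfl
    · refine ⟨b, ?_⟩
      rintro r (rfl | rfl) hr
      · exact absurd hr hH.2
      · rfl
    · refine ⟨a, ?_⟩
      rintro r (rfl | rfl) hr
      · rfl
      · exact absurd hr hH.2
  obtain ⟨p, hpH, hpt⟩ := hH.1.exists_mem_verts_ne t
  have hpS : p ∉ S := fun h => hpt (ht p h hpH)
  let R : V → Prop := Relation.ReflTransGen (fun a b => G.Adj a b ∧ b ∉ S) p
  have hRS : ∀ q, R q → q ∉ S := by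
    intro q hq
    cases hq with
    | refl => exact hpS
    | tail _ h => exact h.2
  refine ⟨{q | R q}, ⟨⟨p, .refl⟩, Set.disjoint_left.2 hRS, ?_, ?_⟩, ?_⟩
  · refine connected_induce_iff_closed.2 ⟨⟨p, .refl⟩, ?_⟩
    rintro C ⟨r, hr, hrC⟩ hC
    have hback : p ∈ C := by
      induction hr with
      | refl => exact hrC
      | tail hb hbc ih => exact ih (hC _ (hb.tail hbc) hrC _ hb hbc.1.symm)
    intro q hq
    induction hq with
    | refl => exact hback
    | tail hb hbc ih => exact hC _ hb ih _ (hb.tail hbc) hbc.1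
  · exact fun a ha b hb hab => ha.tail ⟨hab, hb⟩
  · intro q hq
    by_cases hqS : q ∈ S
    · exact .inr hqS
    · refine .inl (hH.1.isTwoConnClosed.2 {r | r.1 ∈ S} ?_ {r | R r} ⟨⟨p, hpH⟩, .refl, hpS⟩ ?_
        ⟨q, hq⟩ hqS)
      · exact fun a ha b hb => Subtype.ext ((ht _ ha a.2).trans (ht _ hb b.2).symm)
      · exact fun a ha _ b hb hab => ha.tail ⟨H.adj_sub hab, hb⟩

/-- Elementary properties of Kuratowski witnesses in an apex obstruction of
connectivity at least two. -/
theorem elementary_witness_properties {V : Type} [Fintype V] (G : SimpleGraph V)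
    (hG : IsApexObstruction G) (hconn : 2 ≤ vConn G)
    (u v w : V) (Hu Hv Hw : G.Subgraph)
    (hu : IsKuratowskiWitness G u Hu) (hv : IsKuratowskiWitness G v Hv)
    (hw : IsKuratowskiWitness G w Hw) :
    (Hu.verts ∩ Hv.verts).Nonempty ∧
    (Hu.verts ∩ Hv.verts ∩ Hw.verts = ∅ →
      G.edgeSet = Hu.edgeSet ∪ Hv.edgeSet ∪ Hw.edgeSet) ∧
    (Hu.verts ∩ Hv.verts ∩ Hw.verts = ∅ →
      ∀ x ∈ Hu.verts \ (Hv.verts ∪ Hw.verts), IsBranchVertex Hu x) ∧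
    (vConn G = 2 →
      ∀ S : Set V, IsTwoCut G S → ∀ s ∈ S, ∀ Hs : G.Subgraph,
        IsKuratowskiWitness G s Hs → ∃ C : Set V, IsCompOf G S C ∧ Hs.verts ⊆ C ∪ S) := by
  obtain ⟨-, hclosed⟩ := connected_induce_iff_closed.1
    (connected_of_vConn_pos (by omega : 0 < vConn G))
  refine ⟨?_, hG.edgeSet_eq hu.1 hv.1 hw.1, ?_, fun _ S hS s hs Hs hHs =>
    hHs.exists_isCompOf hS hs⟩
  · by_contra hne
    rw [Set.not_nonempty_iff_eq_empty] at hne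
    have hE := hG.edgeSet_eq hu.1 hv.1 hv.1 (by simp [hne])
    obtain ⟨p, hp, -⟩ := hu.1.exists_mem_verts_ne u
    obtain ⟨q, hq, -⟩ := hv.1.exists_mem_verts_ne u
    have hdisj : ∀ z, z ∈ Hu.verts → z ∉ Hv.verts := fun z hz hz' =>
      (hne ▸ ⟨hz, hz'⟩ : z ∈ (∅ : Set V))
    refine hdisj q (hclosed Hu.verts ⟨p, trivial, hp⟩ ?_ trivial) hq
    intro a _ ha b _ hab
    have hab : s(a, b) ∈ G.edgeSet := hab
    rw [hE] at hab
    rcases hab with (h | h) | h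
    · exact (Subgraph.mem_edgeSet.1 h).snd_mem
    · exact absurd (Subgraph.mem_edgeSet.1 h).fst_mem (hdisj a ha)
    · exact absurd (Subgraph.mem_edgeSet.1 h).fst_mem (hdisj a ha)
  · rintro hdisj x ⟨hxu, hx⟩
    have hxv : x ∉ Hv.verts := fun h => hx (.inl h)
    have hxw : x ∉ Hw.verts := fun h => hx (.inr h)
    obtain ⟨y, hxy⟩ : ∃ y, G.Adj x y := by
      by_contra! hcon
      obtain ⟨q, -, hq⟩ := hu.1.exists_mem_verts_ne x
      exact hq (hclosed {x} ⟨x, trivial, rfl⟩ (fun a _ ha b _ hab =>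
        absurd (ha ▸ hab) (hcon b)) trivial)
    have hE : s(x, y) ∈ G.edgeSet := hxy
    rw [hG.edgeSet_eq hu.1 hv.1 hw.1 hdisj] at hE
    rcases hE with (h | h) | h
    · exact hG.isBranchVertex hu.1 hv.1 hw.1 hdisj h hxv hxw
    · exact absurd (Subgraph.mem_edgeSet.1 h).fst_mem hxv
    · exact absurd (Subgraph.mem_edgeSet.1 h).fst_mem hxw
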